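/- arXiv:2203.01712 — 2 statements merged into one kernel-verified Lean document; each statement's English description precedes it below -/
import Mathlib

section
/- Let (X_n)_{n∈ℕ} be a sequence of random vectors in ℝ^d that converges mod-Gaussian in the Fourier sense with parameters t_n K (where t_n → +∞ and K is a positive-definite symmetric d×d matrix) and some continuous limiting function θ with θ(0)=1. Then the rescaled random vectors Y_n = X_n/√(t_n) converge in distribution to the centered Gaussian law N(0,K) on ℝ^d. -/
open MeasureTheory Filter
open scoped Topology ENNReal BigOperators

noncomputable section

/-- The quadratic form `x ↦ xᵗ K x` associated to a `d × d` real matrix. -/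
def qf {d : ℕ} (K : Matrix (Fin d) (Fin d) ℝ) (x : EuclideanSpace ℝ (Fin d)) : ℝ :=
  ∑ i, ∑ j, x i * K i j * x j

/-- The Gaussian distribution `N(0, K)` on `ℝ^d`, given by its density
`(2π)^{-d/2} (det K)^{-1/2} exp(-xᵗK⁻¹x/2)` with respect to Lebesgue measure. -/
def gaussianMeasure (d : ℕ) (K : Matrix (Fin d) (Fin d) ℝ) :
    Measure (EuclideanSpace ℝ (Fin d)) :=
  volume.withDensity fun x =>
    ENNReal.ofReal (Real.sqrt (((2 * Real.pi) ^ d * K.det)⁻¹) * Real.exp (-(qf K⁻¹ x) / 2))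

open Matrix in
lemma qf_eq_dot {d : ℕ} (K : Matrix (Fin d) (Fin d) ℝ) (x : EuclideanSpace ℝ (Fin d)) :
    qf K x = x.ofLp ⬝ᵥ (K *ᵥ x.ofLp) := by
  simp [qf, dotProduct, mulVec, Finset.mul_sum, mul_assoc]

open Matrix in
lemma qf_smul {d : ℕ} (K : Matrix (Fin d) (Fin d) ℝ) (c : ℝ) (x : EuclideanSpace ℝ (Fin d)) :
    qf K (c • x) = c ^ 2 * qf K x := by
  simp [qf_eq_dot, mulVec_smul]; ring

open scoped MatrixOrder ComplexOrder Matrix.Norms.L2Operator in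
lemma exists_sqrt {d : ℕ} {K : Matrix (Fin d) (Fin d) ℝ} (hK : K.PosDef) :
    ∃ A : Matrix (Fin d) (Fin d) ℝ, A * A = K ∧ A.transpose = A := by
  refine ⟨CFC.sqrt K, CFC.sqrt_mul_sqrt_self _ hK.posSemidef.nonneg, ?_⟩
  have := (CFC.sqrt_nonneg K).isSelfAdjoint
  simpa [IsSelfAdjoint, Matrix.star_eq_conjTranspose] using this

open Matrix in
lemma qf_inv_comp {d : ℕ} {K A : Matrix (Fin d) (Fin d) ℝ} (hdet : A.det ≠ 0)
    (hA : A * A = K) (hs : A.transpose = A) (y : EuclideanSpace ℝ (Fin d)) :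
    qf K⁻¹ (A.toEuclideanLin y) = ‖y‖ ^ 2 := by
  have hu : IsUnit A.det := isUnit_iff_ne_zero.mpr hdet
  have h1 : A * (K⁻¹ * A) = 1 := by
    rw [← hA, Matrix.mul_inv_rev, Matrix.mul_assoc, Matrix.nonsing_inv_mul _ hu, Matrix.mul_one,
      Matrix.mul_nonsing_inv _ hu]
  rw [qf_eq_dot, Matrix.toEuclideanLin_apply]
  simp only [mulVec_mulVec]
  have h2 : (A *ᵥ y.ofLp) = y.ofLp ᵥ* A := by
    rw [← Matrix.vecMul_transpose, hs]
  rw [h2, ← Matrix.dotProduct_mulVec, mulVec_mulVec, h1, one_mulVec, EuclideanSpace.norm_sq_eq]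
  simp [dotProduct, sq]

open Matrix in
lemma norm_sq_toLin {d : ℕ} {K A : Matrix (Fin d) (Fin d) ℝ}
    (hA : A * A = K) (hs : A.transpose = A) (y : EuclideanSpace ℝ (Fin d)) :
    ‖A.toEuclideanLin y‖ ^ 2 = qf K y := by
  have h2 : (A *ᵥ y.ofLp) = y.ofLp ᵥ* A := by
    rw [← Matrix.vecMul_transpose, hs]
  rw [qf_eq_dot, ← hA, ← mulVec_mulVec, dotProduct_mulVec, ← h2, EuclideanSpace.norm_sq_eq]
  simp [dotProduct, sq, Matrix.toEuclideanLin_apply]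

open Matrix in
lemma inner_toLin {d : ℕ} {A : Matrix (Fin d) (Fin d) ℝ}
    (hs : A.transpose = A) (x y : EuclideanSpace ℝ (Fin d)) :
    inner ℝ (A.toEuclideanLin x) y = inner ℝ (A.toEuclideanLin y) x := by
  have h := Matrix.toEuclideanLin_conjTranspose_eq_adjoint A
  have h' : A.conjTranspose = A := by rw [Matrix.conjTranspose_eq_transpose_of_trivial, hs]
  rw [h'] at h
  conv_lhs => rw [h]
  rw [LinearMap.adjoint_inner_left, real_inner_comm]

lemma continuous_qf {d : ℕ} (K : Matrix (Fin d) (Fin d) ℝ) : Continuous (qf K) := by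
  unfold qf; fun_prop

lemma charFun_gaussianMeasure {d : ℕ} {K : Matrix (Fin d) (Fin d) ℝ} (hK : K.PosDef)
    (ζ : EuclideanSpace ℝ (Fin d)) :
    charFun (gaussianMeasure d K) ζ = Complex.exp (((-(qf K ζ) / 2 : ℝ) : ℂ)) := by
  obtain ⟨A, hA, hs⟩ := exists_sqrt hK
  have hKd : K.det = A.det ^ 2 := by rw [← hA, Matrix.det_mul, sq]
  have hdet : A.det ≠ 0 := by
    intro h
    have := hK.det_pos
    rw [hKd, h] at this
    simp at this
  have hq := continuous_qf K⁻¹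
  rw [charFun_apply, gaussianMeasure, integral_withDensity_eq_integral_toReal_smul
    (by fun_prop) (ae_of_all _ fun _ => ENNReal.ofReal_lt_top)]
  set c : ℝ := Real.sqrt (((2 * Real.pi) ^ d * K.det)⁻¹) with hc
  set g : EuclideanSpace ℝ (Fin d) → ℂ := fun x =>
    Complex.exp (((-(qf K⁻¹ x) / 2 : ℝ) : ℂ) + (inner ℝ x ζ : ℝ) * Complex.I) with hg
  have hgc : Continuous g := by rw [hg]; fun_prop
  have e1 : ∀ x : EuclideanSpace ℝ (Fin d),
      (ENNReal.ofReal (c * Real.exp (-(qf K⁻¹ x) / 2))).toReal •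
        Complex.exp ((inner ℝ x ζ : ℝ) * Complex.I) = (c : ℂ) * g x := by
    intro x
    rw [ENNReal.toReal_ofReal (by positivity), Complex.real_smul]
    simp only [hg]
    rw [Complex.exp_add]
    push_cast
    ring
  simp_rw [e1]
  rw [integral_const_mul]
  have hld : LinearMap.det A.toEuclideanLin = A.det := by
    rw [Matrix.toEuclideanLin_eq_toLin, LinearMap.det_toLin]
  have hmap := Measure.map_linearMap_addHaar_eq_smul_addHaar
    (volume : Measure (EuclideanSpace ℝ (Fin d))) (f := A.toEuclideanLin) (by rwa [hld])
  have hcont : Continuous A.toEuclideanLin := LinearMap.continuous_of_finiteDimensional _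
  have hint : ∫ y, g (A.toEuclideanLin y) = |A.det⁻¹| • ∫ x, g x := by
    rw [← integral_map (φ := A.toEuclideanLin) hcont.aemeasurable hgc.aestronglyMeasurable, hmap, hld,
      integral_smul_measure, ENNReal.toReal_ofReal (abs_nonneg _)]
  have hint2 : ∫ y, g (A.toEuclideanLin y) =
      ((Real.sqrt ((2 * Real.pi) ^ d) : ℝ) : ℂ) * Complex.exp (((-(qf K ζ) / 2 : ℝ) : ℂ)) := by
    have h := GaussianFourier.integral_cexp_neg_mul_sq_norm_add (b := (1 / 2 : ℂ))
      (by norm_num) Complex.I (A.toEuclideanLin ζ)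
    have e2 : ∀ y, g (A.toEuclideanLin y) = Complex.exp (-(1 / 2 : ℂ) * (‖y‖ : ℂ) ^ 2 +
        Complex.I * (inner ℝ (A.toEuclideanLin ζ) y : ℝ)) := by
      intro y
      simp only [hg]
      rw [qf_inv_comp hdet hA hs, inner_toLin hs]
      congr 1
      push_cast
      ring
    simp_rw [e2]
    rw [h]
    congr 1
    · rw [finrank_euclideanSpace_fin, Real.sqrt_eq_rpow, ← Real.rpow_natCast,
        ← Real.rpow_mul (by positivity), Complex.ofReal_cpow (by positivity)]
      push_cast
      congr 1 <;> ring
    · rw [← Complex.ofReal_pow, norm_sq_toLin hA hs]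
      congr 1
      push_cast
      rw [Complex.I_sq]
      ring
  have hd : |A.det| ≠ 0 := abs_ne_zero.mpr hdet
  have hint3 : ∫ x, g x = (|A.det| : ℝ) * (((Real.sqrt ((2 * Real.pi) ^ d) : ℝ) : ℂ) *
      Complex.exp (((-(qf K ζ) / 2 : ℝ) : ℂ))) := by
    rw [← hint2, hint, abs_inv, Complex.real_smul, ← mul_assoc, ← Complex.ofReal_mul,
      mul_inv_cancel₀ hd]
    simp
  have hcc : c * |A.det| * Real.sqrt ((2 * Real.pi) ^ d) = 1 := by
    rw [hc, hKd, Real.sqrt_inv, Real.sqrt_mul (by positivity), Real.sqrt_sq_eq_abs]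
    have : Real.sqrt ((2 * Real.pi) ^ d) ≠ 0 := by positivity
    field_simp
  rw [hint3, ← mul_assoc, ← mul_assoc, ← Complex.ofReal_mul, ← Complex.ofReal_mul, hcc]
  simp

lemma isProbabilityMeasure_gaussianMeasure {d : ℕ} {K : Matrix (Fin d) (Fin d) ℝ}
    (hK : K.PosDef) : IsProbabilityMeasure (gaussianMeasure d K) := by
  have h := charFun_gaussianMeasure hK 0
  rw [charFun_zero] at h
  have h1 : (gaussianMeasure d K).real Set.univ = 1 := by
    have : qf K 0 = 0 := by simp [qf]
    rw [this] at h
    simp only [neg_zero, zero_div, Complex.ofReal_zero, Complex.exp_zero] at h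
    exact_mod_cast h
  constructor
  rw [measureReal_def] at h1
  rwa [ENNReal.toReal_eq_one_iff] at h1

/-- If `(X_n)` converges mod-Gaussian in the Fourier sense with parameters
`t_n K` (`t_n → ∞`, `K` positive-definite symmetric) and continuous limiting function `θ`
with `θ(0) = 1`, then `Y_n = X_n / √t_n` converges in distribution to `N(0, K)`. -/
theorem modGaussian_centralLimitTheorem
    (d : ℕ) (Ω : Type*) [MeasurableSpace Ω] (ℙ : Measure Ω) [IsProbabilityMeasure ℙ]
    (X : ℕ → Ω → EuclideanSpace ℝ (Fin d)) (hX : ∀ n, Measurable (X n))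
    (t : ℕ → ℝ) (ht : Tendsto t atTop atTop)
    (K : Matrix (Fin d) (Fin d) ℝ) (hK : K.PosDef)
    (θ : EuclideanSpace ℝ (Fin d) → ℂ) (hθcont : Continuous θ) (hθ0 : θ 0 = 1)
    (hmod : TendstoLocallyUniformly
      (fun n ζ => (∫ ω, Complex.exp (Complex.I * ((∑ i, ζ i * X n ω i : ℝ) : ℂ)) ∂ℙ) *
        Complex.exp (((t n * qf K ζ / 2 : ℝ) : ℂ)))
      θ atTop) :
    ∀ f : BoundedContinuousFunction (EuclideanSpace ℝ (Fin d)) ℝ,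
      Tendsto (fun n => ∫ ω, f ((Real.sqrt (t n))⁻¹ • X n ω) ∂ℙ) atTop
        (𝓝 (∫ x, f x ∂(gaussianMeasure d K))) := by
  intro f
  have hprob := isProbabilityMeasure_gaussianMeasure hK
  have hm : ∀ n, Measurable (fun ω => (Real.sqrt (t n))⁻¹ • X n ω) :=
    fun n => by have := hX n; fun_prop
  let μ : ℕ → ProbabilityMeasure (EuclideanSpace ℝ (Fin d)) := fun n =>
    ⟨ℙ.map (fun ω => (Real.sqrt (t n))⁻¹ • X n ω),
      Measure.isProbabilityMeasure_map (hm n).aemeasurable⟩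
  let μ₀ : ProbabilityMeasure (EuclideanSpace ℝ (Fin d)) := ⟨gaussianMeasure d K, hprob⟩
  have key : Tendsto μ atTop (𝓝 μ₀) := by
    rw [ProbabilityMeasure.tendsto_iff_tendsto_charFun]
    intro ζ
    have hg : Tendsto (fun n => (Real.sqrt (t n))⁻¹ • ζ) atTop (𝓝 0) := by
      have h0 : Tendsto (fun n => (Real.sqrt (t n))⁻¹) atTop (𝓝 0) :=
        (Real.tendsto_sqrt_atTop.comp ht).inv_tendsto_atTop
      simpa using h0.smul_const ζ
    have h1 := hmod.tendsto_comp hθcont.continuousAt hg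
    rw [hθ0] at h1
    have h2 := h1.mul_const (Complex.exp (((-(qf K ζ) / 2 : ℝ) : ℂ)))
    rw [one_mul] at h2
    change Tendsto (fun n => charFun (ℙ.map (fun ω => (Real.sqrt (t n))⁻¹ • X n ω)) ζ) atTop
      (𝓝 (charFun (gaussianMeasure d K) ζ))
    rw [charFun_gaussianMeasure hK]
    refine h2.congr' ?_
    filter_upwards [ht.eventually_gt_atTop 0] with n hn
    have e : t n * qf K ((Real.sqrt (t n))⁻¹ • ζ) / 2 = qf K ζ / 2 := by
      rw [qf_smul, inv_pow, Real.sq_sqrt hn.le]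
      field_simp
    rw [e, mul_assoc, ← Complex.exp_add, ← Complex.ofReal_add]
    have e0 : qf K ζ / 2 + -qf K ζ / 2 = 0 := by ring
    rw [e0, Complex.ofReal_zero, Complex.exp_zero, mul_one, charFun_apply,
      integral_map (hm n).aemeasurable (by fun_prop)]
    congr 1
    funext ω
    rw [mul_comm]
    congr 3
    simp only [PiLp.inner_apply, PiLp.smul_apply, smul_eq_mul, RCLike.inner_apply, conj_trivial]
    refine Finset.sum_congr rfl fun i _ => ?_
    ring
  have h := ProbabilityMeasure.tendsto_iff_forall_integral_tendsto.mp key f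
  refine h.congr fun n => ?_
  change ∫ x, f x ∂(ℙ.map (fun ω => (Real.sqrt (t n))⁻¹ • X n ω)) = _
  rw [integral_map (hm n).aemeasurable f.continuous.aestronglyMeasurable]

end
end

section
/- Let μ and ν be Borel probability measures on ℝ^d with finite moments of all orders, and let ρ_ε be the rescaled smoothing kernel ρ_ε(x) = ((2d+2)^{3/2}/ε)^d ρ((2d+2)^{3/2} x/ε), where ρ(x) is proportional to ∏_{i=1}^d (sinc(x^{(i)}/(2d+2)))^{2d+2}. If ε ≤ 1/√(2d+2), then ‖(μ−ν) * ρ_ε‖ ≤ 4 (d+1)^{(d+1)/2} Δ_ε(μ̂, ν̂), where ‖·‖ is the total variation norm of a signed measure. -/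
open MeasureTheory Filter
open scoped Topology ENNReal BigOperators

noncomputable section

/-- Partial derivative of a function `f : ℝ^d → ℂ` of order `r` in the coordinate directions
`j 0, …, j (r-1)`; for a multi-index `β` this represents `∂^{|β|} f / ∂ζ^β`. -/
def pderivMulti {d : ℕ} (f : EuclideanSpace ℝ (Fin d) → ℂ) (r : ℕ) (j : Fin r → Fin d)
    (ζ : EuclideanSpace ℝ (Fin d)) : ℂ :=
  iteratedFDeriv ℝ r f ζ fun k => EuclideanSpace.single (j k) 1

/-- `Δ_ε(f)`: the maximum over all multi-indices `β` with `|β| ≤ d+1` of the integral of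
`|∂^{|β|}f/∂ζ^β|` over the cube `[−(2d+2)^{3/2}/ε, (2d+2)^{3/2}/ε]^d`. -/
def DeltaEps (d : ℕ) (f : EuclideanSpace ℝ (Fin d) → ℂ) (ε : ℝ) : ℝ :=
  ⨆ r : Fin (d + 2), ⨆ j : Fin (r : ℕ) → Fin d,
    ∫ ζ in {ζ : EuclideanSpace ℝ (Fin d) | ∀ i, |ζ i| ≤ (2 * d + 2 : ℝ) ^ ((3 : ℝ) / 2) / ε},
      ‖pderivMulti f r j ζ‖

/-- The Fourier transform of a measure on `ℝ^d`. -/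
def charFunM {d : ℕ} (μ : Measure (EuclideanSpace ℝ (Fin d)))
    (ζ : EuclideanSpace ℝ (Fin d)) : ℂ :=
  ∫ x, Complex.exp (Complex.I * ((∑ i, ζ i * x i : ℝ) : ℂ)) ∂μ

/-- The (unnormalized) sine cardinal, `sinc x = sin x / x` with `sinc 0 = 1`. -/
def sinc (x : ℝ) : ℝ := if x = 0 then 1 else Real.sin x / x

/-- The unnormalized smoothing kernel `∏ᵢ (sinc(xᶦ/(2d+2)))^{2d+2}`. -/
def kernelBase (d : ℕ) (x : EuclideanSpace ℝ (Fin d)) : ℝ :=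
  ∏ i, sinc (x i / (2 * d + 2)) ^ (2 * d + 2)

/-- The normalized smoothing kernel `ρ`. -/
def smoothKernel (d : ℕ) (x : EuclideanSpace ℝ (Fin d)) : ℝ :=
  kernelBase d x / ∫ y, kernelBase d y

/-- The rescaled smoothing kernel `ρ_ε(x) = ((2d+2)^{3/2}/ε)^d ρ((2d+2)^{3/2} x / ε)`. -/
def smoothKernelEps (d : ℕ) (ε : ℝ) (x : EuclideanSpace ℝ (Fin d)) : ℝ :=
  ((2 * d + 2 : ℝ) ^ ((3 : ℝ) / 2) / ε) ^ d *
    smoothKernel d ((((2 * d + 2 : ℝ) ^ ((3 : ℝ) / 2)) / ε) • x)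

/-- The total variation norm `‖(μ−ν) * k‖` of the convolution of `μ − ν` with a density `k`. -/
def convNorm {d : ℕ} (μ ν : Measure (EuclideanSpace ℝ (Fin d)))
    (k : EuclideanSpace ℝ (Fin d) → ℝ) : ℝ :=
  ∫ x, |(∫ y, k (x - y) ∂μ) - ∫ y, k (x - y) ∂ν|

/-- The B-spline: `bsp m` is the `(m+1)`-fold convolution of the uniform density on `[-1,1]`. -/
def bsp : ℕ → ℝ → ℝ
  | 0 => Set.indicator (Set.Icc (-1) 1) fun _ => 1 / 2
  | m + 1 => fun t => (1 / 2) * ∫ s in (-1 : ℝ)..1, bsp m (t + s)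

lemma bsp_succ (m : ℕ) (t : ℝ) : bsp (m + 1) t = (1 / 2) * ∫ s in (-1 : ℝ)..1, bsp m (t + s) := rfl

lemma bsp_succ' (m : ℕ) (t : ℝ) : bsp (m + 1) t = (1 / 2) * ∫ s in (t - 1)..(t + 1), bsp m s := by
  rw [bsp_succ, intervalIntegral.integral_comp_add_left]
  simp [sub_eq_add_neg]

lemma abs_bsp_le (m : ℕ) (t : ℝ) : |bsp m t| ≤ 1 / 2 := by
  induction m generalizing t with
  | zero =>
    simp only [bsp, Set.indicator]
    split_ifs <;> norm_num
  | succ m ih =>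
    rw [bsp_succ, abs_mul]
    have := intervalIntegral.norm_integral_le_of_norm_le_const (a := -1) (b := 1)
      (f := fun s => bsp m (t + s)) (C := 1 / 2) (fun s _ => ih (t + s))
    rw [Real.norm_eq_abs] at this
    norm_num at this ⊢
    linarith

lemma bsp_eq_zero (m : ℕ) (t : ℝ) (ht : (m : ℝ) + 1 < |t|) : bsp m t = 0 := by
  induction m generalizing t with
  | zero =>
    simp only [bsp, Set.indicator]
    rw [if_neg]
    intro h
    have := abs_le.2 h
    norm_num at ht
    linarith
  | succ m ih =>
    rw [bsp_succ, intervalIntegral.integral_congr (g := fun _ => (0:ℝ))]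
    · simp
    · intro s hs
      rw [Set.uIcc_of_le (by norm_num)] at hs
      apply ih
      have h1 := abs_le.2 hs
      have h2 := abs_sub_abs_le_abs_sub t (-s)
      rw [abs_neg, sub_neg_eq_add] at h2
      push_cast at ht
      linarith

lemma bsp_meas_cont (m : ℕ) : Measurable (bsp m) ∧ Continuous (bsp (m + 1)) := by
  have key : ∀ m, Measurable (bsp m) → Continuous (bsp (m + 1)) := by
    intro m hm
    have hIntg : ∀ a b, IntervalIntegrable (bsp m) volume a b := by
      intro a b
      rw [intervalIntegrable_iff]
      exact Measure.integrableOn_of_bounded (M := 1 / 2) (by simp)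
        hm.aestronglyMeasurable (ae_of_all _ fun x => abs_bsp_le m x)
    have hc := intervalIntegral.continuous_primitive hIntg 0
    have : bsp (m + 1) = fun t => (1 / 2) * ((∫ s in (0:ℝ)..(t + 1), bsp m s)
        - ∫ s in (0:ℝ)..(t - 1), bsp m s) := by
      ext t
      rw [bsp_succ', intervalIntegral.integral_interval_sub_left (hIntg _ _) (hIntg _ _)]
    rw [this]
    have h1 : Continuous fun t : ℝ => ∫ s in (0:ℝ)..(t + 1), bsp m s :=
      hc.comp (continuous_id.add continuous_const)
    have h2 : Continuous fun t : ℝ => ∫ s in (0:ℝ)..(t - 1), bsp m s :=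
      hc.comp (continuous_id.sub continuous_const)
    exact continuous_const.mul (h1.sub h2)
  have h0 : Measurable (bsp 0) := by
    exact measurable_const.indicator measurableSet_Icc
  induction m with
  | zero => exact ⟨h0, key 0 h0⟩
  | succ m ih => exact ⟨ih.2.measurable, key _ ih.2.measurable⟩

lemma bsp_integrable (m : ℕ) : Integrable (bsp m) := by
  have : IntegrableOn (bsp m) (Set.Icc (-((m:ℝ)+1)) (m+1)) :=
    Measure.integrableOn_of_bounded (M := 1 / 2) (by simp)
        (bsp_meas_cont m).1.aestronglyMeasurable (ae_of_all _ fun x => abs_bsp_le m x)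
  rw [integrableOn_iff_integrable_of_support_subset] at this
  · exact this
  · intro t ht
    by_contra h
    apply ht
    apply bsp_eq_zero
    rw [Set.mem_Icc, ← abs_le] at h
    exact not_le.1 h

lemma bsp_hasDerivAt (m : ℕ) (t : ℝ) :
    HasDerivAt (bsp (m + 2)) ((1 / 2) * (bsp (m + 1) (t + 1) - bsp (m + 1) (t - 1))) t := by
  have hc := (bsp_meas_cont m).2
  have hIntg : ∀ a b, IntervalIntegrable (bsp (m + 1)) volume a b := fun a b =>
    hc.intervalIntegrable a b
  have : bsp (m + 2) = fun t => (1 / 2) * ((∫ s in (0:ℝ)..(t + 1), bsp (m + 1) s)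
        - ∫ s in (0:ℝ)..(t - 1), bsp (m + 1) s) := by
    ext t
    rw [bsp_succ', intervalIntegral.integral_interval_sub_left (hIntg _ _) (hIntg _ _)]
  rw [this]
  have h : ∀ x, HasDerivAt (fun t => ∫ s in (0:ℝ)..t, bsp (m + 1) s) (bsp (m + 1) x) x := fun x =>
    intervalIntegral.integral_hasDerivAt_right (hIntg _ _)
      hc.aestronglyMeasurable.stronglyMeasurableAtFilter hc.continuousAt
  exact (((h (t + 1)).comp_add_const t 1).sub ((h (t - 1)).comp_sub_const t 1)).const_mul _

lemma bsp_contDiff (m : ℕ) : ContDiff ℝ m (bsp (m + 1)) := by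
  induction m with
  | zero => exact contDiff_zero.2 (bsp_meas_cont 0).2
  | succ m ih =>
    push_cast
    rw [contDiff_succ_iff_deriv]
    refine ⟨fun t => (bsp_hasDerivAt m t).differentiableAt, by simp, ?_⟩
    have : deriv (bsp (m + 1 + 1)) =
        fun t => (1 / 2) * (bsp (m + 1) (t + 1) - bsp (m + 1) (t - 1)) :=
      funext fun t => (bsp_hasDerivAt m t).deriv
    rw [this]
    fun_prop

lemma bsp_iteratedDeriv_le (k m : ℕ) (h : k ≤ m) (t : ℝ) :
    |iteratedDeriv k (bsp (m + 1)) t| ≤ 1 / 2 := by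
  induction k generalizing m t with
  | zero => simpa using abs_bsp_le (m + 1) t
  | succ k ih =>
    obtain ⟨m, rfl⟩ : ∃ m', m = m' + 1 := ⟨m - 1, by omega⟩
    have hd : deriv (bsp (m + 1 + 1)) =
        fun t => (1 / 2) * (bsp (m + 1) (t + 1) - bsp (m + 1) (t - 1)) :=
      funext fun t => (bsp_hasDerivAt m t).deriv
    have hcd : ContDiff ℝ k (bsp (m + 1)) := (bsp_contDiff m).of_le (by exact_mod_cast (by omega))
    rw [iteratedDeriv_succ', hd, iteratedDeriv_const_mul_field, iteratedDeriv_fun_sub,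
      iteratedDeriv_comp_add_const, iteratedDeriv_comp_sub_const]
    · have h1 := ih m (by omega) (t + 1)
      have h2 := ih m (by omega) (t - 1)
      rw [abs_le] at *
      constructor <;> linarith
    · exact (hcd.comp (contDiff_id.add contDiff_const)).contDiffAt
    · exact (hcd.comp (contDiff_id.sub contDiff_const)).contDiffAt

lemma bsp_iteratedDeriv_eq_zero (k m : ℕ) (t : ℝ) (ht : (m : ℝ) + 2 < |t|) :
    iteratedDeriv k (bsp (m + 1)) t = 0 := by
  have hev : bsp (m + 1) =ᶠ[𝓝 t] fun _ => 0 := by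
    filter_upwards [(isOpen_lt continuous_const continuous_abs).mem_nhds ht] with s hs
    apply bsp_eq_zero
    push_cast
    have : (m : ℝ) + 2 < |s| := hs
    linarith
  rw [(hev.iteratedDeriv_eq k)]
  simp

lemma expint (s : ℝ) : ∫ u in (-1 : ℝ)..1, Complex.exp (-Complex.I * (s * u : ℝ)) =
    2 * (sinc s : ℂ) := by
  by_cases hs : s = 0
  · simp [hs, sinc]; norm_num
  · have hc : (-Complex.I * s) ≠ 0 := by simp [hs]
    have := integral_exp_mul_complex (a := -1) (b := 1) hc
    have h2 : (fun u : ℝ => Complex.exp (-Complex.I * (s * u : ℝ))) =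
        fun u : ℝ => Complex.exp (-Complex.I * s * u) := by
      ext u; push_cast; ring_nf
    rw [h2, this, sinc, if_neg hs]
    push_cast
    rw [Complex.sin]
    have hs' : (s : ℂ) ≠ 0 := by exact_mod_cast hs
    field_simp
    ring_nf
    simp

lemma bsp_fourier (m : ℕ) (s : ℝ) :
    ∫ t, Complex.exp (-Complex.I * (s * t : ℝ)) * (bsp m t : ℂ) = (sinc s : ℂ) ^ (m + 1) := by
  induction m with
  | zero =>
    have : (fun t => Complex.exp (-Complex.I * (s * t : ℝ)) * (bsp 0 t : ℂ)) =
        Set.indicator (Set.Icc (-1) 1) fun t =>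
          (1 / 2 : ℂ) * Complex.exp (-Complex.I * (s * t : ℝ)) := by
      ext t
      simp only [bsp, Set.indicator]
      split_ifs <;> simp
      ring
    rw [this, integral_indicator measurableSet_Icc, integral_Icc_eq_integral_Ioc,
      ← intervalIntegral.integral_of_le (by norm_num), intervalIntegral.integral_const_mul,
      expint]
    ring
  | succ m ih =>
    have hE : ∀ x : ℝ, ‖Complex.exp (-Complex.I * (x : ℝ))‖ = 1 := by
      intro x
      rw [show -Complex.I * (x : ℂ) = ((-x : ℝ) : ℂ) * Complex.I by push_cast; ring]
      exact Complex.norm_exp_ofReal_mul_I _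
    have h1 : ∀ t, Complex.exp (-Complex.I * (s * t : ℝ)) * (bsp (m + 1) t : ℂ) =
        ∫ u in Set.Ioc (-1 : ℝ) 1,
          (1 / 2 : ℂ) * (Complex.exp (-Complex.I * (s * t : ℝ)) * (bsp m (t + u) : ℂ)) := by
      intro t
      rw [bsp_succ, intervalIntegral.integral_of_le (by norm_num)]
      simp_rw [← mul_assoc]
      rw [integral_const_mul, integral_complex_ofReal]
      push_cast
      ring
    simp_rw [h1]
    rw [integral_integral_swap]
    · have h2 : ∀ u : ℝ, (∫ t, (1 / 2 : ℂ) * (Complex.exp (-Complex.I * (s * t : ℝ))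
          * (bsp m (t + u) : ℂ))) =
          (1 / 2 : ℂ) * (sinc s : ℂ) ^ (m + 1) * Complex.exp (-Complex.I * (-s * u : ℝ)) := by
        intro u
        have h3 := integral_add_right_eq_self (μ := volume) (fun t : ℝ =>
          Complex.exp (-Complex.I * (s * (t - u) : ℝ)) * (bsp m t : ℂ)) u
        simp only [add_sub_cancel_right] at h3
        rw [integral_const_mul, h3, ← ih, mul_assoc, ← integral_mul_const]
        congr 1
        apply integral_congr_ae
        refine ae_of_all _ fun t => ?_
        dsimp only
        rw [mul_right_comm, ← Complex.exp_add]
        congr 2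
        push_cast
        ring
      simp_rw [h2]
      rw [integral_const_mul, ← intervalIntegral.integral_of_le (by norm_num), expint]
      have : sinc (-s) = sinc s := by simp [sinc]
      rw [this]
      ring
    · have hb := bsp_integrable m
      have hI : Integrable (fun p : ℝ × ℝ => bsp m (p.1 + p.2))
          (volume.prod (volume.restrict (Set.Ioc (-1 : ℝ) 1))) := by
        rw [integrable_prod_iff']
        · refine ⟨ae_of_all _ fun u => hb.comp_add_right u, ?_⟩
          have : (fun y : ℝ => ∫ x : ℝ, ‖bsp m (x + y)‖) = fun _ => ∫ x, ‖bsp m x‖ := by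
            ext y
            exact integral_add_right_eq_self (fun x => ‖bsp m x‖) y
          simp only [this]
          exact integrable_const _
        · exact ((bsp_meas_cont m).1.comp
            (measurable_fst.add measurable_snd)).aestronglyMeasurable
      have hI2 := hI.ofReal (𝕜 := ℂ)
      refine Integrable.const_mul ?_ _
      refine hI2.bdd_mul (c := 1) ?_ ?_
      · apply Continuous.aestronglyMeasurable
        fun_prop
      · exact ae_of_all _ fun p => (hE _).le
lemma sinc_eq : sinc = Real.sinc := by
  ext x; simp [sinc, Real.sinc]

lemma sinc_continuous : Continuous sinc := by rw [sinc_eq]; exact Real.continuous_sinc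

lemma sinc_lower (s : ℝ) : 1 - s ^ 2 / 6 ≤ sinc s := by
  have key : ∀ s : ℝ, 0 < s → 1 - s ^ 2 / 6 ≤ sinc s := by
    intro s hs
    rw [sinc, if_neg hs.ne', le_div_iff₀ hs]
    have := Real.sin_ge_sub_cube hs.le
    nlinarith
  rcases lt_trichotomy s 0 with h | h | h
  · have := key (-s) (by linarith)
    rw [show sinc (-s) = sinc s by simp [sinc]] at this
    simpa using this
  · simp [h, sinc]
  · exact key s h

lemma sinc_sq_le (s : ℝ) : sinc s ^ 2 ≤ 2 * (1 + s ^ 2)⁻¹ := by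
  have h1 : sinc s ^ 2 ≤ 1 := by
    rw [sinc_eq, sq_le_one_iff_abs_le_one]; exact Real.abs_sinc_le_one s
  have h2 : s ^ 2 * sinc s ^ 2 ≤ 1 := by
    by_cases hs : s = 0
    · simp [hs]
    · rw [sinc, if_neg hs, div_pow, mul_div_cancel₀ _ (pow_ne_zero 2 hs)]
      exact Real.sin_sq_le_one s
  rw [← div_eq_mul_inv, le_div_iff₀ (by positivity)]
  linarith

lemma sinc_pow_integrable (d : ℕ) : Integrable fun s => sinc s ^ (2 * d + 2) := by
  refine Integrable.mono' (integrable_inv_one_add_sq.const_mul 2)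
    (sinc_continuous.pow _).aestronglyMeasurable (ae_of_all _ fun s => ?_)
  refine le_trans ?_ (sinc_sq_le s)
  have h1 : |sinc s| ≤ 1 := by rw [sinc_eq]; exact Real.abs_sinc_le_one s
  rw [Real.norm_eq_abs, abs_pow, ← sq_abs]
  exact pow_le_pow_of_le_one (abs_nonneg _) h1 (by omega)

/-- The one dimensional normalising constant. -/
def Zone (d : ℕ) : ℝ := ∫ s, sinc s ^ (2 * d + 2)

lemma Zone_lower (d : ℕ) : (4 / 3) / Real.sqrt (d + 1) ≤ Zone d := by
  set q := Real.sqrt ((d : ℝ) + 1) with hq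
  have hq0 : 0 < q := Real.sqrt_pos.2 (by positivity)
  have hq2 : q ^ 2 = d + 1 := Real.sq_sqrt (by positivity)
  have h1 : ∫ s in Set.Icc (-(1 / q)) (1 / q), (2 / 3 : ℝ) = (4 / 3) / q := by
    simp
    rw [max_eq_left (by positivity)]
    field_simp
    ring
  have h2 : ∫ s in Set.Icc (-(1 / q)) (1 / q), (2 / 3 : ℝ) ≤
      ∫ s in Set.Icc (-(1 / q)) (1 / q), sinc s ^ (2 * d + 2) := by
    apply setIntegral_mono_on (integrableOn_const (by simp)) (sinc_pow_integrable d).integrableOn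
      measurableSet_Icc
    intro s hs
    have hs1 : |s| ≤ 1 / q := abs_le.2 hs
    have hs2 : s ^ 2 ≤ 1 / (d + 1) := by
      rw [← sq_abs, ← hq2, ← one_div_pow]
      exact pow_le_pow_left₀ (abs_nonneg _) hs1 2
    have hs3 : s ^ 2 * (d + 1) ≤ 1 := by
      rwa [le_div_iff₀ (by positivity)] at hs2
    have hs4 : s ^ 2 ≤ 1 := le_trans hs2 (by rw [div_le_one (by positivity)]; linarith [(Nat.cast_nonneg d : (0:ℝ) ≤ d)])
    have hb := one_add_mul_le_pow (a := - (s ^ 2 / 6)) (by linarith) (2 * d + 2)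
    have hp : (1 + -(s ^ 2 / 6)) ^ (2 * d + 2) ≤ sinc s ^ (2 * d + 2) :=
      pow_le_pow_left₀ (by linarith) (by have := sinc_lower s; linarith) _
    refine le_trans ?_ (hb.trans hp)
    push_cast
    linarith
  rw [← h1]
  refine h2.trans (setIntegral_le_integral (sinc_pow_integrable d) (ae_of_all _ fun s => ?_))
  change 0 ≤ sinc s ^ (2 * d + 2)
  rw [show 2 * d + 2 = 2 * (d + 1) by ring, pow_mul]
  exact pow_nonneg (sq_nonneg _) _

lemma Zone_pos (d : ℕ) : 0 < Zone d := lt_of_lt_of_le (by positivity) (Zone_lower d)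

lemma Zone_bound (d : ℕ) (hd : 0 < d) :
    2 * ((d : ℝ) + 1) * (1 / Zone d) ^ d ≤ 4 * ((d : ℝ) + 1) ^ (((d : ℝ) + 1) / 2) := by
  set q := Real.sqrt ((d : ℝ) + 1) with hq
  have hq0 : 0 < q := Real.sqrt_pos.2 (by positivity)
  have hq2 : q ^ 2 = d + 1 := Real.sq_sqrt (by positivity)
  have h1 : ((d : ℝ) + 1) ^ (((d : ℝ) + 1) / 2) = q ^ (d + 1) := by
    rw [hq, Real.sqrt_eq_rpow, ← Real.rpow_natCast, ← Real.rpow_mul (by positivity)]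
    congr 1
    push_cast
    ring
  have h2 : 1 / Zone d ≤ (3 / 4) * q := by
    rw [div_le_iff₀ (Zone_pos d)]
    have := Zone_lower d
    rw [← hq, div_le_iff₀ hq0] at this
    nlinarith
  have h3 : (1 / Zone d) ^ d ≤ ((3 / 4) * q) ^ d :=
    pow_le_pow_left₀ (one_div_nonneg.2 (Zone_pos d).le) h2 d
  have h4 : q * (3 / 4) ^ d ≤ 2 := by
    apply le_of_sq_le_sq _ (by norm_num)
    rw [mul_pow, hq2, ← pow_mul, mul_comm d 2, pow_mul]
    have hb := one_add_mul_le_pow (a := (7 / 9 : ℝ)) (by norm_num) d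
    have : ((3 / 4 : ℝ) ^ 2) ^ d * (1 + 7 / 9) ^ d = 1 := by
      rw [← mul_pow]; norm_num
    have hp : 0 ≤ ((3 / 4 : ℝ) ^ 2) ^ d := by positivity
    nlinarith
  rw [h1, ← hq2]
  calc 2 * q ^ 2 * (1 / Zone d) ^ d ≤ 2 * q ^ 2 * ((3 / 4) * q) ^ d := by gcongr
    _ = 2 * q ^ (d + 1) * (q * (3 / 4) ^ d) := by rw [mul_pow]; ring
    _ ≤ 2 * q ^ (d + 1) * 2 := by gcongr
    _ = _ := by ring

lemma integral_euclid {d : ℕ} {G : Type*} [NormedAddCommGroup G] [NormedSpace ℝ G]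
    (f : EuclideanSpace ℝ (Fin d) → G) :
    ∫ x, f x = ∫ y : Fin d → ℝ, f (WithLp.toLp 2 y) :=
  ((PiLp.volume_preserving_toLp (Fin d)).integral_comp
    (MeasurableEquiv.toLp 2 (Fin d → ℝ)).measurableEmbedding f).symm

lemma integral_kernelBase (d : ℕ) : ∫ y, kernelBase d y = ((2 * d + 2) * Zone d) ^ d := by
  rw [integral_euclid]
  simp only [kernelBase]
  rw [integral_fintype_prod_volume_eq_pow (fun s : ℝ => sinc (s / (2 * d + 2)) ^ (2 * d + 2)),
    Fintype.card_fin]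
  have := Measure.integral_comp_div (fun s => sinc s ^ (2 * d + 2)) (2 * (d : ℝ) + 2)
  rw [this, Zone, abs_of_pos (by positivity), smul_eq_mul]

/-- The (unnormalised) Fourier side of the kernel. -/
def pker (d : ℕ) (a : ℝ) (ζ : EuclideanSpace ℝ (Fin d)) : ℝ := ∏ i, bsp (2 * d + 1) (a * ζ i)

lemma bsp_fourier_scaled (m : ℕ) (a x : ℝ) (ha : 0 < a) :
    ∫ t, Complex.exp (-Complex.I * (t * x : ℝ)) * (bsp m (a * t) : ℂ) =
      (1 / a : ℂ) * (sinc (x / a) : ℂ) ^ (m + 1) := by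
  rw [← bsp_fourier]
  have := Measure.integral_comp_mul_left
    (fun t : ℝ => Complex.exp (-Complex.I * (x / a * t : ℝ)) * (bsp m t : ℂ)) a
  rw [abs_of_pos (by positivity)] at this
  rw [Complex.real_smul] at this
  push_cast at this ⊢
  rw [one_div, ← this]
  congr 1
  ext t
  congr 3
  have : (a : ℂ) ≠ 0 := by exact_mod_cast ha.ne'
  field_simp

lemma kernel_rep (d : ℕ) (ε : ℝ) (hε : 0 < ε) (a : ℝ)
    (ha : a = (2 * d + 2) / ((2 * d + 2 : ℝ) ^ ((3 : ℝ) / 2) / ε))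
    (x : EuclideanSpace ℝ (Fin d)) :
    (smoothKernelEps d ε x : ℂ) = ((1 / Zone d) ^ d : ℝ) *
      ∫ ζ : EuclideanSpace ℝ (Fin d), Complex.exp (-Complex.I * (∑ i, ζ i * x i : ℝ)) *
        (pker d a ζ : ℂ) := by
  set M := (2 * d + 2 : ℝ) ^ ((3 : ℝ) / 2) / ε with hM
  have hM0 : 0 < M := by positivity
  have ha0 : 0 < a := by rw [ha]; positivity
  have h1 : ∫ ζ : EuclideanSpace ℝ (Fin d), Complex.exp (-Complex.I * (∑ i, ζ i * x i : ℝ)) *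
        (pker d a ζ : ℂ) = ∏ i, ((1 / a : ℂ) * (sinc (x i / a) : ℂ) ^ (2 * d + 2)) := by
    rw [integral_euclid]
    simp_rw [← bsp_fourier_scaled _ a _ ha0]
    rw [← integral_fintype_prod_volume_eq_prod
      (fun (i : Fin d) (t : ℝ) =>
        Complex.exp (-Complex.I * (t * x i : ℝ)) * (bsp (2 * d + 1) (a * t) : ℂ))]
    congr 1
    ext ζ
    rw [Finset.prod_mul_distrib, ← Complex.exp_sum, ← Finset.mul_sum]
    simp [pker]
  rw [h1, Finset.prod_mul_distrib, Finset.prod_const, Finset.card_univ, Fintype.card_fin]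
  simp only [smoothKernelEps, smoothKernel, integral_kernelBase]
  rw [← hM]
  have h2 : kernelBase d (M • x) = ∏ i, sinc (x i / a) ^ (2 * d + 2) := by
    simp only [kernelBase, PiLp.smul_apply, smul_eq_mul]
    refine Finset.prod_congr rfl fun i _ => ?_
    congr 2
    rw [ha]
    field_simp
  rw [h2]
  norm_cast
  rw [← mul_assoc, mul_div_assoc', ← mul_pow, mul_comm (M ^ d), mul_div_assoc, ← div_pow, mul_comm]
  congr 2
  have := Zone_pos d
  rw [ha]
  field_simp
  push_cast
  ring
/-- Radial weight. -/
def wgt (d : ℕ) (r : ℝ) : ℝ := if r ≤ 1 then 1 else (r ^ (d + 1))⁻¹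

lemma wgt_oned (d : ℕ) (hd : 0 < d) :
    IntegrableOn (fun y : ℝ => y ^ (d - 1) • wgt d y) (Set.Ioi 0) ∧
    ∫ y in Set.Ioi (0:ℝ), y ^ (d - 1) • wgt d y = 1 / d + 1 := by
  have e1 : Set.EqOn (fun y : ℝ => y ^ (d - 1) • wgt d y) (fun y => y ^ (d - 1))
      (Set.Ioc 0 1) := by
    intro y hy
    simp [wgt, hy.2]
  have e2 : Set.EqOn (fun y : ℝ => y ^ (d - 1) • wgt d y) (fun y => y ^ (-2 : ℝ))
      (Set.Ioi 1) := by
    intro y hy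
    have hy1 : 1 < y := hy
    have hy0 : 0 < y := by linarith
    simp only [wgt, not_le.2 hy1, if_false, smul_eq_mul]
    rw [Real.rpow_neg hy0.le, Real.rpow_two, show d + 1 = (d - 1) + 2 by omega, pow_add]
    field_simp
  have i1 : IntegrableOn (fun y : ℝ => y ^ (d - 1) • wgt d y) (Set.Ioc 0 1) := by
    rw [integrableOn_congr_fun e1 measurableSet_Ioc]
    exact (continuous_pow _).integrableOn_Ioc
  have i2 : IntegrableOn (fun y : ℝ => y ^ (d - 1) • wgt d y) (Set.Ioi 1) := by
    rw [integrableOn_congr_fun e2 measurableSet_Ioi]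
    exact integrableOn_Ioi_rpow_of_lt (by norm_num) (by norm_num)
  rw [← Set.Ioc_union_Ioi_eq_Ioi (zero_le_one (α := ℝ))]
  refine ⟨i1.union i2, ?_⟩
  rw [setIntegral_union (Set.Ioc_disjoint_Ioi le_rfl) measurableSet_Ioi i1 i2,
    setIntegral_congr_fun measurableSet_Ioc e1, setIntegral_congr_fun measurableSet_Ioi e2,
    integral_Ioi_rpow_of_lt (by norm_num) (by norm_num),
    ← intervalIntegral.integral_of_le (by norm_num), integral_pow]
  have : ((d - 1 : ℕ) : ℝ) + 1 = d := by
    have : d - 1 + 1 = d := by omega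
    exact_mod_cast this
  rw [this, show d - 1 + 1 = d by omega, zero_pow hd.ne']
  norm_num

lemma wgt_int (d : ℕ) (hd : 0 < d) :
    Integrable (fun x : EuclideanSpace ℝ (Fin d) => wgt d ‖WithLp.ofLp x‖) ∧
    ∫ x : EuclideanSpace ℝ (Fin d), wgt d ‖WithLp.ofLp x‖ = (d + 1) * 2 ^ d := by
  have : Nonempty (Fin d) := ⟨⟨0, hd⟩⟩
  obtain ⟨h1, h2⟩ := wgt_oned d hd
  have hfin : Module.finrank ℝ (Fin d → ℝ) = d := by simp
  constructor
  · have := (integrable_fun_norm_addHaar (E := Fin d → ℝ) volume (f := wgt d)).2 (by rwa [hfin])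
    exact (PiLp.volume_preserving_ofLp (Fin d)).integrable_comp_of_integrable this
  · rw [integral_euclid]
    have := integral_fun_norm_addHaar (E := Fin d → ℝ) volume (wgt d)
    rw [hfin, h2] at this
    simp only [this]
    rw [Measure.real, Real.volume_pi_ball _ one_pos]
    simp
    have : (d : ℝ) ≠ 0 := by exact_mod_cast hd.ne'
    field_simp
    ring

lemma iteratedFDeriv_line {d : ℕ} (F : EuclideanSpace ℝ (Fin d) → ℂ) (k : ℕ)
    (hF : ContDiff ℝ k F) (ζ v : EuclideanSpace ℝ (Fin d)) :
    iteratedFDeriv ℝ k F ζ (fun _ => v) = iteratedDeriv k (fun t : ℝ => F (ζ + t • v)) 0 := by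
  set L : ℝ →L[ℝ] EuclideanSpace ℝ (Fin d) := (ContinuousLinearMap.id ℝ ℝ).smulRight v with hL
  have h1 : (fun t : ℝ => F (ζ + t • v)) = (fun y => F (ζ + y)) ∘ L := by
    ext t; simp [hL]
  have h2 : ContDiff ℝ k (fun y => F (ζ + y)) := hF.comp (contDiff_const.add contDiff_id)
  rw [iteratedDeriv_eq_iteratedFDeriv, h1, L.iteratedFDeriv_comp_right h2 0 le_rfl]
  rw [iteratedFDeriv_comp_add_left]
  simp [hL]

lemma fourier_bound {d : ℕ} (F : EuclideanSpace ℝ (Fin d) → ℂ) (N : ℕ)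
    (hF : ContDiff ℝ N F) (hs : HasCompactSupport F) (k : ℕ) (hk : k ≤ N)
    (x : EuclideanSpace ℝ (Fin d)) (i : Fin d) :
    |x i| ^ k * ‖∫ ζ : EuclideanSpace ℝ (Fin d), Complex.exp (-Complex.I * (∑ i, ζ i * x i : ℝ)) *
      F ζ‖ ≤ ∫ ζ, ‖iteratedFDeriv ℝ k F ζ (fun _ => EuclideanSpace.single i (1 : ℝ))‖ := by
  have hIntg : ∀ n : ℕ, (n : ℕ∞) ≤ (N : ℕ∞) → Integrable (iteratedFDeriv ℝ n F) := by
    intro n hn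
    exact (hF.continuous_iteratedFDeriv (by exact_mod_cast hn)).integrable_of_hasCompactSupport
      (hs.iteratedFDeriv n)
  have hfun := Real.fourier_iteratedFDeriv (N := (N : ℕ∞)) (by exact_mod_cast hF) hIntg
    (n := k) (by exact_mod_cast hk)
  set w : EuclideanSpace ℝ (Fin d) := (2 * Real.pi)⁻¹ • x with hw
  have hT : FourierTransform.fourier F w = ∫ ζ : EuclideanSpace ℝ (Fin d),
      Complex.exp (-Complex.I * (∑ i, ζ i * x i : ℝ)) * F ζ := by
    rw [Real.fourier_eq']
    congr 1
    ext ζ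
    rw [smul_eq_mul, hw, inner_smul_right, PiLp.inner_apply]
    congr 2
    have : (∑ i, inner ℝ (ζ i) (x i)) = ∑ i, ζ i * x i := by
      refine Finset.sum_congr rfl fun i _ => ?_
      simp [mul_comm]
    rw [this]
    generalize (∑ i, ζ i * x i) = S
    have := Real.pi_ne_zero
    rw [show -2 * Real.pi * ((2 * Real.pi)⁻¹ * S) = -S by field_simp]
    push_cast; ring
  rw [← hT]
  have hv := congrArg (fun T => T (fun _ : Fin k => EuclideanSpace.single i (1 : ℝ)))
    (congrFun hfun w)
  simp only [VectorFourier.fourierPowSMulRight_apply] at hv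
  have hn := congrArg norm hv
  have hR : ‖(-(2 * (Real.pi : ℂ) * Complex.I)) ^ k • ((∏ _ : Fin k,
      (-innerSL ℝ) w (EuclideanSpace.single i (1 : ℝ))) • FourierTransform.fourier F w)‖ =
      |x i| ^ k * ‖FourierTransform.fourier F w‖ := by
    rw [norm_smul, norm_smul, Finset.prod_const, norm_pow, norm_pow, Finset.card_univ,
      Fintype.card_fin, ← mul_assoc, ← mul_pow]
    congr 2
    simp [hw, abs_of_pos Real.pi_pos, EuclideanSpace.inner_single_right]
    have := Real.pi_ne_zero
    field_simp
  rw [hR] at hn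
  rw [← hn, Real.fourier_eq, ContinuousMultilinearMap.integral_apply]
  · refine (norm_integral_le_integral_norm _).trans (le_of_eq ?_)
    congr 1
    ext ζ
    change ‖Real.fourierChar (-inner ℝ ζ w) •
      (iteratedFDeriv ℝ k F ζ fun _ => EuclideanSpace.single i (1 : ℝ))‖ = _
    rw [Circle.norm_smul]
  · exact (Real.fourierIntegral_convergent_iff w).2 (hIntg k (by exact_mod_cast hk))

lemma cube_compact (d : ℕ) (M : ℝ) :
    IsCompact {ζ : EuclideanSpace ℝ (Fin d) | ∀ i, |ζ i| ≤ M} := by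
  have h := (isCompact_univ_pi (fun _ : Fin d => isCompact_Icc (a := -M) (b := M))).image
    (PiLp.continuous_toLp 2 (fun _ : Fin d => ℝ))
  convert h
  ext ζ
  simp only [Set.mem_ofPred_eq, Set.mem_image, Set.mem_univ_pi, Set.mem_Icc, ← abs_le]
  constructor
  · intro hz
    exact ⟨ζ.ofLp, hz, by simp⟩
  · rintro ⟨y, hy, rfl⟩
    exact hy

lemma norm_iteratedDeriv_ofReal (g : ℝ → ℝ) (k : ℕ) (hg : ContDiff ℝ k g) (t : ℝ) :
    ‖iteratedDeriv k (fun s => (g s : ℂ)) t‖ = |iteratedDeriv k g t| := by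
  rw [← norm_iteratedFDeriv_eq_norm_iteratedDeriv,
    ← Real.norm_eq_abs, ← norm_iteratedFDeriv_eq_norm_iteratedDeriv]
  exact Complex.ofRealLI.norm_iteratedFDeriv_comp_left (hg.contDiffAt) le_rfl

lemma pker_contDiff (d : ℕ) (a : ℝ) : ContDiff ℝ ((2 * d : ℕ) : ℕ∞) (pker d a) := by
  have hb : ContDiff ℝ ((2 * d : ℕ) : ℕ∞) (bsp (2 * d + 1)) := by
    exact_mod_cast bsp_contDiff (2 * d)
  unfold pker
  refine contDiff_prod fun i _ => hb.comp ?_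
  fun_prop

lemma pker_zero (d : ℕ) (a M : ℝ) (ha : 0 < a) (haM : a * M = 2 * d + 2)
    (ζ : EuclideanSpace ℝ (Fin d)) (hζ : ¬ ∀ i, |ζ i| ≤ M) : pker d a ζ = 0 := by
  push Not at hζ
  obtain ⟨i, hi⟩ := hζ
  refine Finset.prod_eq_zero (Finset.mem_univ i) (bsp_eq_zero _ _ ?_)
  rw [abs_mul, abs_of_pos ha]
  push_cast
  nlinarith

lemma pker_compact (d : ℕ) (a M : ℝ) (ha : 0 < a) (haM : a * M = 2 * d + 2) :
    HasCompactSupport (pker d a) :=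
  HasCompactSupport.intro (cube_compact d M) fun ζ hζ => pker_zero d a M ha haM ζ hζ

lemma pker_line (d : ℕ) (a : ℝ) (ζ : EuclideanSpace ℝ (Fin d)) (i : Fin d) (t : ℝ) :
    pker d a (ζ + t • EuclideanSpace.single i (1 : ℝ)) =
      (∏ j ∈ Finset.univ.erase i, bsp (2 * d + 1) (a * ζ j)) *
        bsp (2 * d + 1) (a * ζ i + a * t) := by
  rw [pker, ← Finset.mul_prod_erase _ _ (Finset.mem_univ i), mul_comm]
  congr 1
  · refine Finset.prod_congr rfl fun j hj => ?_
    simp [Finset.ne_of_mem_erase hj]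
  · simp [mul_add]

lemma pker_line_deriv (d : ℕ) (a : ℝ) (ζ : EuclideanSpace ℝ (Fin d)) (i : Fin d) (k : ℕ)
    (hk : k ≤ 2 * d) :
    ‖iteratedDeriv k (fun t : ℝ =>
      (pker d a (ζ + t • EuclideanSpace.single i (1 : ℝ)) : ℂ)) 0‖ =
    |∏ j ∈ Finset.univ.erase i, bsp (2 * d + 1) (a * ζ j)| *
      (|a| ^ k * |iteratedDeriv k (bsp (2 * d + 1)) (a * ζ i)|) := by
  have hb : ContDiff ℝ k (bsp (2 * d + 1)) :=
    (bsp_contDiff (2 * d)).of_le (by exact_mod_cast hk)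
  have hb' : ContDiff ℝ k (fun s => bsp (2 * d + 1) (a * ζ i + s)) :=
    hb.comp (contDiff_const.add contDiff_id)
  simp_rw [pker_line]
  rw [norm_iteratedDeriv_ofReal, iteratedDeriv_const_mul_field, abs_mul]
  · congr 1
    rw [iteratedDeriv_comp_const_mul hb' a, iteratedDeriv_comp_const_add]
    simp [abs_mul, abs_pow]
  · have : ContDiff ℝ k (fun t : ℝ => a * t) := by fun_prop
    exact contDiff_const.mul (hb'.comp this)

lemma pker_line_deriv_le (d : ℕ) (a M : ℝ) (ha : 0 < a) (haM : a * M = 2 * d + 2)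
    (ζ : EuclideanSpace ℝ (Fin d)) (i : Fin d) (k : ℕ) (hk : k ≤ 2 * d) :
    ‖iteratedDeriv k (fun t : ℝ =>
      (pker d a (ζ + t • EuclideanSpace.single i (1 : ℝ)) : ℂ)) 0‖ ≤
    Set.indicator {ζ : EuclideanSpace ℝ (Fin d) | ∀ i, |ζ i| ≤ M}
      (fun _ => a ^ k * (1 / 2) ^ d) ζ := by
  rw [pker_line_deriv d a ζ i k hk, Finset.abs_prod]
  by_cases hζ : ∀ i, |ζ i| ≤ M
  · rw [Set.indicator_of_mem (by exact hζ), abs_of_pos ha]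
    have h1 : ∏ j ∈ Finset.univ.erase i, |bsp (2 * d + 1) (a * ζ j)| ≤ (1 / 2) ^ (d - 1) := by
      refine (Finset.prod_le_prod (fun _ _ => abs_nonneg _)
        (fun j _ => abs_bsp_le (2 * d + 1) (a * ζ j))).trans ?_
      simp
    have h2 := bsp_iteratedDeriv_le k (2 * d) hk (a * ζ i)
    have hd : d = d - 1 + 1 := by have := i.2; omega
    calc _ ≤ (1 / 2 : ℝ) ^ (d - 1) * (a ^ k * (1 / 2)) := by gcongr
      _ = a ^ k * (1 / 2) ^ (d - 1 + 1) := by ring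
      _ = _ := by rw [← hd]
  · rw [Set.indicator_of_notMem (by exact hζ)]
    push Not at hζ
    obtain ⟨j, hj⟩ := hζ
    have hbig : ((2 * d : ℕ) : ℝ) + 2 < |a * ζ j| := by
      rw [abs_mul, abs_of_pos ha]
      push_cast
      nlinarith
    by_cases hji : j = i
    · subst hji
      rw [bsp_iteratedDeriv_eq_zero _ _ _ hbig]
      simp
    · rw [Finset.prod_eq_zero (i := j) (by simp [hji])]
      · simp
      · rw [bsp_eq_zero, abs_zero]
        push_cast at hbig ⊢
        linarith
lemma charFunM_eq {d : ℕ} (μ : Measure (EuclideanSpace ℝ (Fin d))) :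
    charFunM μ = charFun μ := by
  ext ζ
  rw [charFunM, charFun_apply]
  congr 1
  ext x
  congr 1
  rw [PiLp.inner_apply, mul_comm]
  congr 2

lemma charFunM_contDiff {d : ℕ} (μ : Measure (EuclideanSpace ℝ (Fin d)))
    [IsProbabilityMeasure μ] (hmom : ∀ k : ℕ, Integrable (fun x => ‖x‖ ^ k) μ) (n : ℕ∞) :
    ContDiff ℝ n (charFunM μ) := by
  rw [charFunM_eq]
  refine contDiff_charFun' fun k => ?_
  by_cases hk : k = 0
  · subst hk
    simp [memLp_zero_iff_aestronglyMeasurable, aestronglyMeasurable_id]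
  · refine (integrable_norm_rpow_iff aestronglyMeasurable_id (by exact_mod_cast hk)
      (by simp)).1 ?_
    simpa using hmom k

lemma exp_norm_one (x : ℝ) : ‖Complex.exp (-Complex.I * (x : ℂ))‖ = 1 := by
  rw [show -Complex.I * (x : ℂ) = ((-x : ℝ) : ℂ) * Complex.I by push_cast; ring]
  exact Complex.norm_exp_ofReal_mul_I _

lemma conv_rep (d : ℕ) (ε : ℝ) (hε : 0 < ε) (a M : ℝ)
    (hM : M = (2 * d + 2 : ℝ) ^ ((3 : ℝ) / 2) / ε)
    (ha : a = (2 * d + 2) / M)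
    (μ : Measure (EuclideanSpace ℝ (Fin d))) [IsProbabilityMeasure μ]
    (x : EuclideanSpace ℝ (Fin d)) :
    ((∫ y, smoothKernelEps d ε (x - y) ∂μ : ℝ) : ℂ) = ((1 / Zone d) ^ d : ℝ) *
      ∫ ζ : EuclideanSpace ℝ (Fin d), Complex.exp (-Complex.I * (∑ i, ζ i * x i : ℝ)) *
        (charFunM μ ζ * (pker d a ζ : ℂ)) := by
  have hM0 : 0 < M := by rw [hM]; positivity
  have ha0 : 0 < a := by rw [ha]; positivity
  have haM : a * M = 2 * d + 2 := by rw [ha]; field_simp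
  have hcont : Continuous (pker d a) := (pker_contDiff d a).continuous
  have hpi : Integrable (pker d a) :=
    hcont.integrable_of_hasCompactSupport (pker_compact d a M ha0 haM)
  rw [← integral_complex_ofReal]
  simp_rw [kernel_rep d ε hε a (by rw [ha, hM])]
  rw [integral_const_mul]
  congr 1
  rw [integral_integral_swap]
  · congr 1
    ext ζ
    rw [charFunM, ← integral_mul_const, ← integral_const_mul]
    congr 1
    ext y
    rw [← mul_assoc, ← Complex.exp_add]
    congr 2
    simp only [PiLp.sub_apply, mul_sub, Finset.sum_sub_distrib]
    push_cast
    ring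
  · have hI : Integrable (fun p : EuclideanSpace ℝ (Fin d) × EuclideanSpace ℝ (Fin d) =>
        (pker d a p.2 : ℂ)) (μ.prod volume) := (hpi.ofReal (𝕜 := ℂ)).comp_snd μ
    refine hI.bdd_mul (c := 1) ?_ ?_
    · apply Continuous.aestronglyMeasurable
      fun_prop
    · exact ae_of_all _ fun p => (exp_norm_one _).le

lemma deltaEps_ge (d : ℕ) (f : EuclideanSpace ℝ (Fin d) → ℂ) (ε : ℝ) (r : ℕ) (hr : r ≤ d + 1)
    (i : Fin d) :
    ∫ ζ in {ζ : EuclideanSpace ℝ (Fin d) | ∀ i, |ζ i| ≤ (2 * d + 2 : ℝ) ^ ((3 : ℝ) / 2) / ε},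
      ‖iteratedFDeriv ℝ r f ζ (fun _ => EuclideanSpace.single i (1 : ℝ))‖ ≤ DeltaEps d f ε := by
  unfold DeltaEps
  have h1 := le_ciSup (f := fun r : Fin (d + 2) => ⨆ j : Fin (r : ℕ) → Fin d,
    ∫ ζ in {ζ : EuclideanSpace ℝ (Fin d) | ∀ i, |ζ i| ≤ (2 * d + 2 : ℝ) ^ ((3 : ℝ) / 2) / ε},
      ‖pderivMulti f r j ζ‖) (Set.finite_range _).bddAbove ⟨r, by omega⟩
  refine le_trans ?_ h1
  exact le_ciSup (f := fun j : Fin r → Fin d =>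
    ∫ ζ in {ζ : EuclideanSpace ℝ (Fin d) | ∀ i, |ζ i| ≤ (2 * d + 2 : ℝ) ^ ((3 : ℝ) / 2) / ε},
      ‖pderivMulti f r j ζ‖) (Set.finite_range _).bddAbove (fun _ => i)

lemma main_deriv_bound (d : ℕ) (ε : ℝ) (hε : 0 < ε) (a M : ℝ)
    (hM : M = (2 * d + 2 : ℝ) ^ ((3 : ℝ) / 2) / ε)
    (ha : a = (2 * d + 2) / M) (f : EuclideanSpace ℝ (Fin d) → ℂ)
    (hf : ContDiff ℝ (d + 1 : ℕ) f) (k : ℕ) (hk : k ≤ d + 1) (i : Fin d) :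
    ∫ ζ, ‖iteratedFDeriv ℝ k (fun ζ => f ζ * (pker d a ζ : ℂ)) ζ
      (fun _ => EuclideanSpace.single i (1 : ℝ))‖ ≤ (1 + a) ^ k * (1 / 2) ^ d * DeltaEps d f ε := by
  have hM0 : 0 < M := by rw [hM]; positivity
  have ha0 : 0 < a := by rw [ha]; positivity
  have haM : a * M = 2 * d + 2 := by rw [ha]; field_simp
  have hd : 0 < d := Fin.pos i
  set v : EuclideanSpace ℝ (Fin d) := EuclideanSpace.single i (1 : ℝ) with hv
  set C := {ζ : EuclideanSpace ℝ (Fin d) | ∀ i, |ζ i| ≤ M} with hC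
  have hCc : IsCompact C := cube_compact d M
  have hp : ContDiff ℝ (d + 1 : ℕ) (fun ζ => (pker d a ζ : ℂ)) := by
    have h1 : ContDiff ℝ (d + 1 : ℕ) (pker d a) :=
      (pker_contDiff d a).of_le (by exact_mod_cast (by omega))
    exact Complex.ofRealCLM.contDiff.comp h1
  have hline : ContDiff ℝ k (fun t : ℝ => t • v) := contDiff_id.smul contDiff_const
  have hcont : ∀ l, l ≤ d + 1 → Continuous fun ζ => ‖iteratedFDeriv ℝ l f ζ (fun _ => v)‖ := by
    intro l hl
    have h0 := hf.continuous_iteratedFDeriv (m := l) (by exact_mod_cast hl)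
    exact ((ContinuousMultilinearMap.apply ℝ (fun _ : Fin l => EuclideanSpace ℝ (Fin d)) ℂ
      (fun _ => v)).continuous.comp h0).norm
  set B : EuclideanSpace ℝ (Fin d) → ℝ := fun ζ => ∑ l ∈ Finset.range (k + 1),
    (k.choose l * (a ^ (k - l) * (1 / 2) ^ d)) * ‖iteratedFDeriv ℝ l f ζ (fun _ => v)‖ with hB
  have hIntg : ∀ l ∈ Finset.range (k + 1), IntegrableOn (fun ζ =>
      (k.choose l * (a ^ (k - l) * (1 / 2) ^ d)) * ‖iteratedFDeriv ℝ l f ζ (fun _ => v)‖) C := by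
    intro l hl
    have := Finset.mem_range.1 hl
    exact ((hcont l (by omega)).continuousOn.integrableOn_compact hCc).const_mul _
  have hBint : IntegrableOn B C := integrable_finsetSum _ hIntg
  have hpt : ∀ ζ, ‖iteratedFDeriv ℝ k (fun ζ => f ζ * (pker d a ζ : ℂ)) ζ (fun _ => v)‖ ≤
      C.indicator B ζ := by
    intro ζ
    have hk' : ((k : ℕ) : WithTop ℕ∞) ≤ ((d + 1 : ℕ) : WithTop ℕ∞) := by exact_mod_cast hk
    have hshift : ContDiff ℝ k (fun t : ℝ => ζ + t • v) := contDiff_const.add hline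
    have hfl : ContDiff ℝ k (fun t : ℝ => f (ζ + t • v)) := (hf.of_le hk').comp hshift
    have hpl : ContDiff ℝ k (fun t : ℝ => (pker d a (ζ + t • v) : ℂ)) :=
      (hp.of_le hk').comp hshift
    rw [iteratedFDeriv_line _ k ((hf.mul hp).of_le hk'),
      iteratedDeriv_fun_mul hfl.contDiffAt hpl.contDiffAt]
    refine (norm_sum_le _ _).trans ?_
    have hterm : ∀ l ∈ Finset.range (k + 1),
        ‖(k.choose l : ℂ) * iteratedDeriv l (fun t : ℝ => f (ζ + t • v)) 0 *
          iteratedDeriv (k - l) (fun t : ℝ => (pker d a (ζ + t • v) : ℂ)) 0‖ ≤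
        k.choose l * ‖iteratedFDeriv ℝ l f ζ (fun _ => v)‖ *
          C.indicator (fun _ => a ^ (k - l) * (1 / 2) ^ d) ζ := by
      intro l hl
      have hl' := Finset.mem_range.1 hl
      rw [norm_mul, norm_mul, Complex.norm_natCast,
        iteratedFDeriv_line f l (hf.of_le (by exact_mod_cast (by omega)))]
      gcongr
      exact pker_line_deriv_le d a M ha0 haM ζ i (k - l) (by omega)
    refine (Finset.sum_le_sum hterm).trans ?_
    by_cases hζ : ζ ∈ C
    · simp only [Set.indicator_of_mem hζ, hB]
      refine le_of_eq (Finset.sum_congr rfl fun l _ => ?_)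
      ring
    · simp only [Set.indicator_of_notMem hζ]
      simp
  have hΔ : ∀ l, l ≤ d + 1 → ∫ ζ in C, ‖iteratedFDeriv ℝ l f ζ (fun _ => v)‖ ≤ DeltaEps d f ε := by
    intro l hl
    have := deltaEps_ge d f ε l hl i
    rwa [← hM] at this
  calc _ ≤ ∫ ζ, C.indicator B ζ := by
        refine integral_mono_of_nonneg (ae_of_all _ fun _ => norm_nonneg _) ?_ (ae_of_all _ hpt)
        rwa [integrable_indicator_iff hCc.measurableSet]
    _ = ∫ ζ in C, B ζ := integral_indicator hCc.measurableSet
    _ = ∑ l ∈ Finset.range (k + 1), (k.choose l * (a ^ (k - l) * (1 / 2) ^ d)) *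
          ∫ ζ in C, ‖iteratedFDeriv ℝ l f ζ (fun _ => v)‖ := by
        rw [hB, integral_finsetSum _ hIntg]
        simp_rw [integral_const_mul]
    _ ≤ ∑ l ∈ Finset.range (k + 1), (k.choose l * (a ^ (k - l) * (1 / 2) ^ d)) *
          DeltaEps d f ε := by
        refine Finset.sum_le_sum fun l hl => ?_
        have := Finset.mem_range.1 hl
        have := hΔ l (by omega)
        gcongr
    _ = _ := by
        rw [add_pow, Finset.sum_mul, Finset.sum_mul]
        refine Finset.sum_congr rfl fun l _ => ?_
        rw [one_pow]
        ring

lemma a_bound (d : ℕ) (ε : ℝ) (hε : 0 < ε) (hεle : ε ≤ 1 / Real.sqrt (2 * d + 2)) (a M : ℝ)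
    (hM : M = (2 * d + 2 : ℝ) ^ ((3 : ℝ) / 2) / ε)
    (ha : a = (2 * d + 2) / M) (k : ℕ) (hk : k ≤ d + 1) : (1 + a) ^ k ≤ 2 := by
  have hn : (0 : ℝ) < 2 * d + 2 := by positivity
  set q := Real.sqrt (2 * (d : ℝ) + 2) with hq
  have hq0 : 0 < q := Real.sqrt_pos.2 hn
  have hq2 : q ^ 2 = 2 * d + 2 := Real.sq_sqrt hn.le
  have hpow : (2 * d + 2 : ℝ) ^ ((3 : ℝ) / 2) = q ^ 3 := by
    rw [hq, Real.sqrt_eq_rpow, ← Real.rpow_natCast, ← Real.rpow_mul hn.le]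
    norm_num
  have ha0 : 0 < a := by rw [ha, hM]; positivity
  have hae : a = ε / q := by
    rw [ha, hM, hpow, ← hq2]
    field_simp
  have ha1 : a ≤ 1 / (2 * d + 2) := by
    rw [hae, ← hq2, div_le_iff₀ hq0]
    refine hεle.trans (le_of_eq ?_)
    field_simp
  have ha2 : a * (d + 1) ≤ 1 / 2 := by
    rw [le_div_iff₀ hn] at ha1
    linarith
  calc (1 + a) ^ k ≤ (1 + a) ^ (d + 1) := pow_le_pow_right₀ (by linarith) hk
    _ ≤ Real.exp a ^ (d + 1) := by
        gcongr
        linarith [Real.add_one_le_exp a]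
    _ = Real.exp (a * (d + 1)) := by
        rw [← Real.exp_nat_mul]; push_cast; ring_nf
    _ ≤ Real.exp (1 / 2) := Real.exp_le_exp.2 ha2
    _ ≤ 2 := by
        have h := Real.exp_one_lt_d9
        have h2 : Real.exp (1 / 2) ^ 2 = Real.exp 1 := by
          rw [← Real.exp_nat_mul]; norm_num
        nlinarith [Real.exp_pos (1 / 2)]

lemma deltaEps_nonneg (d : ℕ) (f : EuclideanSpace ℝ (Fin d) → ℂ) (ε : ℝ) (hd : 0 < d) :
    0 ≤ DeltaEps d f ε :=
  le_trans (integral_nonneg fun _ => norm_nonneg _) (deltaEps_ge d f ε 0 (by omega) ⟨0, hd⟩)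

/-- For probability measures `μ, ν` on `ℝ^d` with moments of all orders and
`ε ≤ 1/√(2d+2)`, `‖(μ−ν) * ρ_ε‖ ≤ 4 (d+1)^{(d+1)/2} Δ_ε(μ̂, ν̂)`. -/
theorem convNorm_le_deltaEps
    (d : ℕ) (hd : 0 < d)
    (μ ν : Measure (EuclideanSpace ℝ (Fin d)))
    (hμ : IsProbabilityMeasure μ) (hν : IsProbabilityMeasure ν)
    (hμmom : ∀ k : ℕ, Integrable (fun x => ‖x‖ ^ k) μ)
    (hνmom : ∀ k : ℕ, Integrable (fun x => ‖x‖ ^ k) ν)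
    (ε : ℝ) (hε : 0 < ε) (hεle : ε ≤ 1 / Real.sqrt (2 * d + 2)) :
    convNorm μ ν (smoothKernelEps d ε) ≤
      4 * ((d : ℝ) + 1) ^ (((d : ℝ) + 1) / 2) *
        DeltaEps d (fun ζ => charFunM μ ζ - charFunM ν ζ) ε := by
  set f : EuclideanSpace ℝ (Fin d) → ℂ := fun ζ => charFunM μ ζ - charFunM ν ζ with hf
  set M := (2 * d + 2 : ℝ) ^ ((3 : ℝ) / 2) / ε with hM
  set a := (2 * d + 2 : ℝ) / M with ha
  have hM0 : 0 < M := by rw [hM]; positivity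
  have ha0 : 0 < a := by rw [ha]; positivity
  have haM : a * M = 2 * d + 2 := by rw [ha]; field_simp
  have hμc : ContDiff ℝ (d + 1 : ℕ) (charFunM μ) := by
    exact_mod_cast charFunM_contDiff μ hμmom (d + 1 : ℕ)
  have hνc : ContDiff ℝ (d + 1 : ℕ) (charFunM ν) := by
    exact_mod_cast charFunM_contDiff ν hνmom (d + 1 : ℕ)
  have hfc : ContDiff ℝ (d + 1 : ℕ) f := hμc.sub hνc
  have hpcr : ContDiff ℝ (d + 1 : ℕ) (pker d a) :=
    (pker_contDiff d a).of_le (by exact_mod_cast (by omega))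
  have hpc : ContDiff ℝ (d + 1 : ℕ) (fun ζ => (pker d a ζ : ℂ)) :=
    Complex.ofRealCLM.contDiff.comp hpcr
  have hps : HasCompactSupport (fun ζ => (pker d a ζ : ℂ)) :=
    (pker_compact d a M ha0 haM).comp_left (g := fun x : ℝ => (x : ℂ)) (by simp)
  set F : EuclideanSpace ℝ (Fin d) → ℂ := fun ζ => f ζ * (pker d a ζ : ℂ) with hF
  have hFc : ContDiff ℝ (d + 1 : ℕ) F := hfc.mul hpc
  have hFs : HasCompactSupport F := hps.mul_left
  set T : EuclideanSpace ℝ (Fin d) → ℂ := fun x => ∫ ζ : EuclideanSpace ℝ (Fin d),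
    Complex.exp (-Complex.I * (∑ i, ζ i * x i : ℝ)) * F ζ with hT
  set D := DeltaEps d f ε with hD
  have hD0 : 0 ≤ D := deltaEps_nonneg d f ε hd
  have hrep : ∀ x, |(∫ y, smoothKernelEps d ε (x - y) ∂μ) - ∫ y, smoothKernelEps d ε (x - y) ∂ν|
      = (1 / Zone d) ^ d * ‖T x‖ := by
    intro x
    have hz : (((∫ y, smoothKernelEps d ε (x - y) ∂μ) -
        ∫ y, smoothKernelEps d ε (x - y) ∂ν : ℝ) : ℂ) = ((1 / Zone d) ^ d : ℝ) * T x := by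
      rw [Complex.ofReal_sub, conv_rep d ε hε a M hM ha μ x, conv_rep d ε hε a M hM ha ν x,
        ← mul_sub, ← integral_sub]
      · congr 2
        ext ζ
        simp only [hF, hf]
        ring
      · refine Continuous.integrable_of_hasCompactSupport ?_ ?_
        · have := hμc.continuous
          have := hpc.continuous
          fun_prop
        · exact (hps.mul_left).mul_left
      · refine Continuous.integrable_of_hasCompactSupport ?_ ?_
        · have := hνc.continuous
          have := hpc.continuous
          fun_prop
        · exact (hps.mul_left).mul_left
    have := congrArg norm hz
    rw [norm_mul, Complex.norm_real, Complex.norm_real, Real.norm_eq_abs, Real.norm_eq_abs] at this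
    rw [this, abs_of_pos (pow_pos (one_div_pos.2 (Zone_pos d)) d)]
  have hbd : ∀ k, k ≤ d + 1 → ∀ x i, |x i| ^ k * ‖T x‖ ≤ 2 * (1 / 2) ^ d * D := by
    intro k hk x i
    refine (fourier_bound F (d + 1) hFc hFs k hk x i).trans ?_
    refine (main_deriv_bound d ε hε a M hM ha f hfc k hk i).trans ?_
    have := a_bound d ε hε hεle a M hM ha k hk
    gcongr
  have hTw : ∀ x, ‖T x‖ ≤ 2 * (1 / 2) ^ d * D * wgt d ‖WithLp.ofLp x‖ := by
    intro x
    unfold wgt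
    split_ifs with h
    · simpa using hbd 0 (by omega) x ⟨0, hd⟩
    · push Not at h
      have hne : Nonempty (Fin d) := ⟨⟨0, hd⟩⟩
      obtain ⟨i, hi⟩ : ∃ i, ‖WithLp.ofLp x‖ = |x i| := by
        obtain ⟨i, -, hi⟩ := Finset.exists_max_image Finset.univ (fun i => |x i|)
          Finset.univ_nonempty
        refine ⟨i, le_antisymm ?_ (norm_le_pi_norm (WithLp.ofLp x) i)⟩
        exact (pi_norm_le_iff_of_nonneg (abs_nonneg _)).2 fun j => hi j (Finset.mem_univ j)
      rw [hi, ← div_eq_mul_inv, le_div_iff₀ (by rw [← hi]; positivity), mul_comm]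
      exact hbd (d + 1) le_rfl x i
  have hw := wgt_int d hd
  have hz0 : 0 ≤ (1 / Zone d) ^ d := pow_nonneg (one_div_nonneg.2 (Zone_pos d).le) d
  unfold convNorm
  simp_rw [hrep]
  calc ∫ x, (1 / Zone d) ^ d * ‖T x‖
      ≤ ∫ x : EuclideanSpace ℝ (Fin d),
          (1 / Zone d) ^ d * (2 * (1 / 2) ^ d * D * wgt d ‖WithLp.ofLp x‖) := by
        refine integral_mono_of_nonneg (ae_of_all _ fun x => mul_nonneg hz0 (norm_nonneg _)) ?_
          (ae_of_all _ fun x => mul_le_mul_of_nonneg_left (hTw x) hz0)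
        exact (hw.1.const_mul _).const_mul _
    _ = (2 * ((d : ℝ) + 1) * (1 / Zone d) ^ d) * D := by
        rw [integral_const_mul, integral_const_mul, hw.2]
        have : (1 / 2 : ℝ) ^ d * 2 ^ d = 1 := by rw [← mul_pow]; norm_num
        linear_combination (2 * ((d : ℝ) + 1) * (1 / Zone d) ^ d * D) * this
    _ ≤ _ := mul_le_mul_of_nonneg_right (Zone_bound d hd) hD0

end
end
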